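/- arXiv:2603.29170 — 4 statements merged into one kernel-verified Lean document; each statement's English description precedes it below -/
import Mathlib

section
/- Let X and Y be real vector spaces. Let 𝔽_X be a family of seminorms on X (each p ∈ 𝔽_X satisfies p(x + y) ≤ p(x) + p(y) and p(a • x) = |a| · p(x)) such that for every u ∈ X the set {p(u) : p ∈ 𝔽_X} is bounded above. Let 𝔽_Y be a family of F-seminorms on Y that is separating (for every y ≠ 0 there exists q ∈ 𝔽_Y with q(y) > 0). Let T : X → Y and x̄ ∈ X. If L₁ and L₂ are linear maps X → Y that both satisfy the Fréchet differentiability conditions for T at x̄ with respect to 𝔽_X and 𝔽_Y, then L₁ = L₂. -/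
/-- An F-seminorm on a real vector space. -/
def IsFSeminorm {V : Type*} [AddCommGroup V] [Module ℝ V] (p : V → ℝ) : Prop :=
  (∀ x, 0 ≤ p x) ∧ (∀ x y, p (x + y) ≤ p x + p y) ∧
  (∀ (a : ℝ) (x : V), |a| ≤ 1 → p (a • x) ≤ p x) ∧
  (∀ x : V, Filter.Tendsto (fun n : ℕ => p ((1 / (n : ℝ)) • x)) Filter.atTop (nhds 0))

/-- The map `L` satisfies the Fréchet differentiability conditions (DZ) and (DR) for `T`
at `x0` with respect to the families of F-seminorms `p` on the domain and `q` on the range. -/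
def SatisfiesFrechetConditions {X Y : Type*} {ι κ : Type*} [AddCommGroup X] [Module ℝ X]
    [AddCommGroup Y] [Module ℝ Y]
    (p : ι → X → ℝ) (q : κ → Y → ℝ) (T : X → Y) (x0 : X) (L : X → Y) : Prop :=
  ∀ (J : Finset κ) (hJ : J.Nonempty) (ε : ℝ), 0 < ε →
    ∃ (I : Finset ι) (hI : I.Nonempty) (δ : ℝ), 0 < δ ∧ ∀ u : X,
      (I.sup' hI (fun i => p i u) = 0 →
        J.sup' hJ (fun j => q j (T (x0 + u) - T x0 - L u)) = 0) ∧
      (0 < I.sup' hI (fun i => p i u) → I.sup' hI (fun i => p i u) < δ →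
        J.sup' hJ (fun j =>
          q j ((I.sup' hI (fun i => p i u))⁻¹ • (T (x0 + u) - T x0 - L u))) < ε)

theorem IsFSeminorm.nsmul_le {V : Type*} [AddCommGroup V] [Module ℝ V] {q : V → ℝ}
    (hq : IsFSeminorm q) (n : ℕ) (x : V) : q ((n : ℝ) • x) ≤ n * q x := by
  obtain ⟨hnonneg, hadd, hbal, htendsto⟩ := hq
  induction n with
  | zero =>
    have hzero : q 0 = 0 := by
      have h := htendsto 0
      simp only [smul_zero] at h
      exact tendsto_nhds_unique tendsto_const_nhds h
    simp [hzero]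
  | succ n ih =>
    have h := hadd ((n : ℝ) • x) x
    push_cast
    rw [add_smul, one_smul]
    linarith

theorem IsFSeminorm.smul_le {V : Type*} [AddCommGroup V] [Module ℝ V] {q : V → ℝ}
    (hq : IsFSeminorm q) {n : ℕ} (hn : 0 < n) {a : ℝ} (ha : |a| ≤ n) (x : V) :
    q (a • x) ≤ n * q x := by
  have hn' : (0 : ℝ) < n := by exact_mod_cast hn
  have h := hq.2.2.1 (a / n) ((n : ℝ) • x)
    (by rw [abs_div, abs_of_pos hn']; exact (div_le_one hn').2 ha)
  rw [smul_smul, div_mul_cancel₀ _ hn'.ne'] at h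
  exact h.trans (hq.nsmul_le n x)

theorem IsFSeminorm.smul_eq_zero {V : Type*} [AddCommGroup V] [Module ℝ V] {q : V → ℝ}
    (hq : IsFSeminorm q) {x : V} (hx : q x = 0) (a : ℝ) : q (a • x) = 0 := by
  obtain ⟨n, hn⟩ := exists_nat_ge |a|
  have hn' : |a| ≤ ((n + 1 : ℕ) : ℝ) := by push_cast; linarith
  have h := hq.smul_le n.succ_pos hn' x
  rw [hx, mul_zero] at h
  exact le_antisymm h (hq.1 _)

theorem IsFSeminorm.sub_le {V : Type*} [AddCommGroup V] [Module ℝ V] {q : V → ℝ}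
    (hq : IsFSeminorm q) (x y : V) : q (x - y) ≤ q x + q y := by
  have h := hq.2.2.1 (-1) y (by simp)
  have h' := hq.2.1 x (-y)
  rw [neg_one_smul] at h
  rw [sub_eq_add_neg]
  linarith

/-- Along a fixed direction `u`, the difference quotients of the remainder become small. -/
theorem SatisfiesFrechetConditions.exists_remainder_le {X Y : Type*} {ι κ : Type*}
    [AddCommGroup X] [Module ℝ X] [AddCommGroup Y] [Module ℝ Y]
    {p : ι → X → ℝ} {q : κ → Y → ℝ} {T L : X → Y} {x0 : X}
    (h : SatisfiesFrechetConditions p q T x0 L)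
    (hpnonneg : ∀ i x, 0 ≤ p i x)
    (hphom : ∀ i (a : ℝ) (x : X), p i (a • x) = |a| * p i x)
    {j : κ} (hq : IsFSeminorm (q j)) {u : X} {n : ℕ} (hn : 0 < n) (hu : ∀ i, p i u ≤ n)
    {ε : ℝ} (hε : 0 < ε) :
    ∃ δ : ℝ, 0 < δ ∧ ∀ t : ℝ, 0 < t → t < δ →
      q j (t⁻¹ • (T (x0 + t • u) - T x0 - L (t • u))) ≤ n * ε := by
  have hn' : (0 : ℝ) < n := by exact_mod_cast hn
  obtain ⟨I, hI, δ, hδ, H⟩ := h {j} (Finset.singleton_nonempty j) ε hε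
  refine ⟨δ / n, div_pos hδ hn', fun t ht htδ => ?_⟩
  obtain ⟨hDZ, hDR⟩ := H (t • u)
  simp only [Finset.sup'_singleton] at hDZ hDR
  set r := I.sup' hI (fun i => p i (t • u)) with hr
  set R := T (x0 + t • u) - T x0 - L (t • u)
  have hr_le : r ≤ t * n := Finset.sup'_le _ _ fun i _ => by
    rw [hphom, abs_of_pos ht]
    exact mul_le_mul_of_nonneg_left (hu i) ht.le
  have hr_nonneg : 0 ≤ r := by
    obtain ⟨i, hi⟩ := hI
    exact (hpnonneg i (t • u)).trans (Finset.le_sup' (fun i => p i (t • u)) hi)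
  rcases hr_nonneg.eq_or_lt with h0 | hpos
  · rw [hq.smul_eq_zero (hDZ h0.symm)]
    positivity
  · have hlt := hDR hpos (hr_le.trans_lt ((lt_div_iff₀ hn').1 htδ))
    have hratio : |t⁻¹ * r| ≤ n := by
      rw [abs_of_pos (by positivity), inv_mul_le_iff₀ ht]
      exact hr_le
    have hle := hq.smul_le hn hratio (r⁻¹ • R)
    rw [smul_smul, mul_inv_cancel_right₀ hpos.ne'] at hle
    exact hle.trans (mul_le_mul_of_nonneg_left hlt.le hn'.le)

theorem stmt5 {X Y : Type*} {ι κ : Type*} [AddCommGroup X] [Module ℝ X]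
    [AddCommGroup Y] [Module ℝ Y]
    (p : ι → X → ℝ)
    (hpadd : ∀ i (x y : X), p i (x + y) ≤ p i x + p i y)
    (hphom : ∀ i (a : ℝ) (x : X), p i (a • x) = |a| * p i x)
    (hbdd : ∀ u : X, ∃ M : ℝ, ∀ i, p i u ≤ M)
    (q : κ → Y → ℝ) (hq : ∀ j, IsFSeminorm (q j))
    (hsep : ∀ y : Y, y ≠ 0 → ∃ j, 0 < q j y)
    (T : X → Y) (x0 : X) (L₁ L₂ : X →ₗ[ℝ] Y)
    (h1 : SatisfiesFrechetConditions p q T x0 (fun u => L₁ u))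
    (h2 : SatisfiesFrechetConditions p q T x0 (fun u => L₂ u)) :
    L₁ = L₂ := by
  have hpnonneg : ∀ i x, 0 ≤ p i x := fun i x => by
    have hzero := hphom i 0 0
    have hneg := hphom i (-1) x
    have hsum := hpadd i x (-x)
    simp only [smul_zero, abs_zero, zero_mul] at hzero
    simp only [neg_smul, one_smul, abs_neg, abs_one, one_mul] at hneg
    rw [add_neg_cancel, hzero, hneg] at hsum
    linarith
  ext u
  by_contra hne
  obtain ⟨j, hj⟩ := hsep (L₂ u - L₁ u) (sub_ne_zero.2 (Ne.symm hne))
  obtain ⟨M, hM⟩ := hbdd u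
  obtain ⟨m, hm⟩ := exists_nat_ge M
  obtain ⟨n, hn, hu⟩ : ∃ n : ℕ, 0 < n ∧ ∀ i, p i u ≤ n :=
    ⟨m + 1, m.succ_pos, fun i => by push_cast; linarith [hM i]⟩
  have hn' : (0 : ℝ) < n := by exact_mod_cast hn
  have hε : 0 < q j (L₂ u - L₁ u) / (4 * n) := by positivity
  obtain ⟨δ₁, hδ₁, H₁⟩ := h1.exists_remainder_le hpnonneg hphom (hq j) hn hu hε
  obtain ⟨δ₂, hδ₂, H₂⟩ := h2.exists_remainder_le hpnonneg hphom (hq j) hn hu hε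
  obtain ⟨t, ht, htδ⟩ := exists_between (lt_min hδ₁ hδ₂)
  have hle₁ := H₁ t ht (htδ.trans_le (min_le_left _ _))
  have hle₂ := H₂ t ht (htδ.trans_le (min_le_right _ _))
  have hsub := (hq j).sub_le (t⁻¹ • (T (x0 + t • u) - T x0 - L₁ (t • u)))
    (t⁻¹ • (T (x0 + t • u) - T x0 - L₂ (t • u)))
  rw [← smul_sub, sub_sub_sub_cancel_left, map_smul, map_smul, ← smul_sub,
    inv_smul_smul₀ ht.ne'] at hsub
  have hquarter : (n : ℝ) * (q j (L₂ u - L₁ u) / (4 * n)) = q j (L₂ u - L₁ u) / 4 := by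
    field_simp
  rw [map_smul] at hle₁ hle₂
  linarith
end

section
/- Let 0 < ρ < 1, let m be a positive integer, and let x̄ ∈ σ_ρ. Set L(u) = (m · x̄(n)^{m−1} · u(n))_{n∈ℕ} for u ∈ σ_ρ, and for u ∈ σ_ρ and k ∈ ℕ set E_k(u) = (x̄(k) + u(k))^m − x̄(k)^m − m · x̄(k)^{m−1} · u(k). Then: (a) L maps σ_ρ into σ_ρ, is linear, and is continuous for the topology of σ_ρ; and (b) for every nonempty finite K ⊆ ℕ and every ε > 0 there exist a nonempty finite I ⊆ ℕ and δ > 0 such that for every u ∈ σ_ρ: if max_{i ∈ I} |u(i)|^ρ = 0 then max_{k ∈ K} |E_k(u)|^ρ = 0, and if 0 < s < δ where s = max_{i ∈ I} |u(i)|^ρ, then max_{k ∈ K} (|E_k(u)| / s)^ρ < ε. (That is, L is the Fréchet derivative of the m-th power operator Q^m at x̄ with respect to the coordinate F-seminorms of σ_ρ.) -/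
/-- The second-order remainder of the `m`-th power is quadratically bounded on the unit interval. -/
theorem exists_pow_remainder_bound (x : ℝ) (m : ℕ) :
    ∃ C : ℝ, 0 ≤ C ∧ ∀ h : ℝ, |h| ≤ 1 →
      |(x + h) ^ m - x ^ m - (m : ℝ) * x ^ (m - 1) * h| ≤ C * h ^ 2 := by
  obtain ⟨q, hq⟩ := Polynomial.powAddExpansion (Polynomial.C x) Polynomial.X m
  obtain ⟨C, hC⟩ := (isCompact_Icc (a := (-1 : ℝ)) (b := 1)).exists_bound_of_continuousOn
    q.continuous.continuousOn
  refine ⟨C, (norm_nonneg _).trans (hC 0 (by norm_num)), fun h hh => ?_⟩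
  have hx := congrArg (Polynomial.eval h) hq
  simp only [Polynomial.eval_pow, Polynomial.eval_add, Polynomial.eval_mul, Polynomial.eval_C,
    Polynomial.eval_X, Polynomial.eval_natCast] at hx
  rw [show (x + h) ^ m - x ^ m - (m : ℝ) * x ^ (m - 1) * h = q.eval h * h ^ 2 by
    rw [hx]; ring, abs_mul, abs_of_nonneg (sq_nonneg h)]
  exact mul_le_mul_of_nonneg_right (hC h (abs_le.mp hh)) (sq_nonneg h)

/-- A sequence with summable `ρ`-th powers is bounded. -/
theorem exists_abs_le_of_summable_rpow {ρ : ℝ} (hρ : 0 < ρ) {x : ℕ → ℝ}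
    (hx : Summable fun n => |x n| ^ ρ) : ∃ B : ℝ, ∀ n, |x n| ≤ B := by
  have hnn : ∀ n, 0 ≤ |x n| ^ ρ := fun n => by positivity
  refine ⟨(∑' n, |x n| ^ ρ) ^ ρ⁻¹, fun n => ?_⟩
  exact (Real.le_rpow_inv_iff_of_pos (abs_nonneg _) (tsum_nonneg hnn) hρ).2
    (hx.le_tsum n fun j _ => hnn j)

theorem stmt13 (ρ : ℝ) (hρ0 : 0 < ρ) (hρ1 : ρ < 1) (m : ℕ) (hm : 0 < m)
    (xb : ℕ → ℝ) (hxb : Summable fun n => |xb n| ^ ρ)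
    (L : (ℕ → ℝ) → (ℕ → ℝ))
    (hL : ∀ u n, L u n = (m : ℝ) * (xb n) ^ (m - 1) * u n)
    (E : (ℕ → ℝ) → ℕ → ℝ)
    (hE : ∀ u k, E u k = (xb k + u k) ^ m - (xb k) ^ m - (m : ℝ) * (xb k) ^ (m - 1) * u k) :
    -- (a) L maps σ_ρ into σ_ρ, is linear and continuous for the topology of σ_ρ
    ((∀ u : ℕ → ℝ, (Summable fun n => |u n| ^ ρ) → Summable fun n => |L u n| ^ ρ) ∧
     (∀ u v : ℕ → ℝ, L (u + v) = L u + L v) ∧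
     (∀ (c : ℝ) (u : ℕ → ℝ), L (c • u) = c • L u) ∧
     Continuous fun u : {t : ℕ → ℝ // Summable fun n => |t n| ^ ρ} => L u.1) ∧
    -- (b) the Fréchet differentiability conditions (DZ) and (DR)
    (∀ (K : Finset ℕ) (hK : K.Nonempty) (ε : ℝ), 0 < ε →
      ∃ (I : Finset ℕ) (hI : I.Nonempty) (δ : ℝ), 0 < δ ∧
        ∀ u : ℕ → ℝ, (Summable fun n => |u n| ^ ρ) →
          (I.sup' hI (fun i => |u i| ^ ρ) = 0 → K.sup' hK (fun k => |E u k| ^ ρ) = 0) ∧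
          (0 < I.sup' hI (fun i => |u i| ^ ρ) → I.sup' hI (fun i => |u i| ^ ρ) < δ →
            K.sup' hK (fun k => (|E u k| / I.sup' hI (fun i => |u i| ^ ρ)) ^ ρ) < ε)) := by
  refine ⟨⟨fun u hu => ?_, fun u v => ?_, fun c u => ?_, ?_⟩, fun K hK ε hε => ?_⟩
  · obtain ⟨B, hB⟩ := exists_abs_le_of_summable_rpow hρ0 hxb
    refine Summable.of_nonneg_of_le (fun n => by positivity) (fun n => ?_)
      (hu.mul_left ((m * B ^ (m - 1)) ^ ρ))
    have hB0 : 0 ≤ B := (abs_nonneg _).trans (hB n)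
    rw [← Real.mul_rpow (by positivity) (abs_nonneg _), hL, abs_mul, abs_mul, abs_pow,
      Nat.abs_cast]
    have := hB n
    gcongr
  · ext n
    simp only [Pi.add_apply, hL]
    ring
  · ext n
    simp only [Pi.smul_apply, smul_eq_mul, hL]
    ring
  · refine continuous_pi fun n => ?_
    simp only [hL]
    exact continuous_const.mul ((continuous_apply n).comp continuous_subtype_val)
  · choose C hC0 hC using fun k => exists_pow_remainder_bound (xb k) m
    have hM0 : 0 ≤ ∑ k ∈ K, C k := Finset.sum_nonneg fun k _ => hC0 k
    set M := ∑ k ∈ K, C k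
    refine ⟨K, hK, min 1 (ε ^ ρ⁻¹ / (M + 1)), by positivity, fun u _ => ⟨fun h0 => ?_, ?_⟩⟩
    · have hE0 : ∀ k ∈ K, |E u k| ^ ρ = 0 := fun k hk => by
        have hle : |u k| ^ ρ ≤ 0 := h0 ▸ Finset.le_sup' (fun i => |u i| ^ ρ) hk
        have huk : u k = 0 := by
          by_contra hne
          exact absurd hle (not_le.2 (Real.rpow_pos_of_pos (abs_pos.2 hne) ρ))
        simp [hE, huk, Real.zero_rpow hρ0.ne']
      rw [Finset.sup'_congr hK rfl hE0, Finset.sup'_const]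
    · set s := K.sup' hK (fun i => |u i| ^ ρ) with hs
      intro hs0 hsδ
      have hs1 : s < 1 := hsδ.trans_le (min_le_left _ _)
      have hsε : s * (M + 1) < ε ^ ρ⁻¹ :=
        (lt_div_iff₀ (by positivity)).1 (hsδ.trans_le (min_le_right _ _))
      refine (Finset.sup'_lt_iff hK).2 fun k hk => ?_
      have hle : |u k| ^ ρ ≤ s := Finset.le_sup' (fun i => |u i| ^ ρ) hk
      have hu1 : |u k| ≤ 1 := by
        by_contra! h
        exact absurd (Real.one_lt_rpow h hρ0) (not_lt.2 (hle.trans hs1.le))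
      have hus : |u k| ≤ s :=
        (Real.self_le_rpow_of_le_one (abs_nonneg _) hu1 hρ1.le).trans hle
      have hCM : C k ≤ M := Finset.single_le_sum (fun j _ => hC0 j) hk
      have hEs : |E u k| / s ≤ s * M := by
        rw [div_le_iff₀ hs0, hE]
        calc _ ≤ C k * u k ^ 2 := hC k (u k) hu1
          _ = C k * |u k| ^ 2 := by rw [sq_abs]
          _ ≤ M * s ^ 2 := by gcongr
          _ = s * M * s := by ring
      exact (Real.lt_rpow_inv_iff_of_pos (by positivity) hε.le hρ0).1 (by linarith)
end

section
/- Let m be a positive integer and let x̄ : ℕ → ℝ be any real sequence. Set L(u) = (m · x̄(n)^{m−1} · u(n))_{n∈ℕ} for u : ℕ → ℝ, and for u : ℕ → ℝ and k ∈ ℕ set E_k(u) = (x̄(k) + u(k))^m − x̄(k)^m − m · x̄(k)^{m−1} · u(k). Then: (a) L : (ℕ → ℝ) → (ℕ → ℝ) is linear and continuous for the product topology; and (b) for every nonempty finite K ⊆ ℕ and every ε > 0 there exist a nonempty finite I ⊆ ℕ and δ > 0 such that for every u : ℕ → ℝ: if max_{i ∈ I} |u(i)|/(1 + |u(i)|)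 = 0 then max_{k ∈ K} |E_k(u)|/(1 + |E_k(u)|) = 0, and if 0 < s < δ where s = max_{i ∈ I} |u(i)|/(1 + |u(i)|), then max_{k ∈ K} (|E_k(u)|/s) / (1 + |E_k(u)|/s) < ε. (That is, L is the Fréchet derivative of the m-th power operator R^m on 𝕊 at x̄ with respect to the F-seminorms ‖x‖_k = |x(k)|/(1 + |x(k)|).) -/
theorem eventually_abs_pow_taylor_remainder_le (m : ℕ) (x : ℝ) {c : ℝ} (hc : 0 < c) :
    ∀ᶠ t : ℝ in nhds 0,
      |(x + t) ^ m - x ^ m - (m : ℝ) * x ^ (m - 1) * t| ≤ c * |t| := by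
  have h := (hasDerivAt_iff_isLittleO_nhds_zero.1 (hasDerivAt_pow m x)).def hc
  simpa [Real.norm_eq_abs, mul_comm, mul_left_comm, mul_assoc] using h

theorem abs_le_two_mul_of_div_one_add_abs_le {a s : ℝ} (hs : s ≤ 1 / 2)
    (h : |a| / (1 + |a|) ≤ s) : |a| ≤ 2 * s := by
  have ha := abs_nonneg a
  rw [div_le_iff₀ (by positivity)] at h
  nlinarith


theorem stmt15 (m : ℕ) (hm : 0 < m) (xb : ℕ → ℝ)
    (L : (ℕ → ℝ) → (ℕ → ℝ))
    (hL : ∀ u n, L u n = (m : ℝ) * (xb n) ^ (m - 1) * u n)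
    (E : (ℕ → ℝ) → ℕ → ℝ)
    (hE : ∀ u k, E u k = (xb k + u k) ^ m - (xb k) ^ m - (m : ℝ) * (xb k) ^ (m - 1) * u k) :
    -- (a) L is linear and continuous for the product topology on ℕ → ℝ
    ((∀ u v : ℕ → ℝ, L (u + v) = L u + L v) ∧
     (∀ (c : ℝ) (u : ℕ → ℝ), L (c • u) = c • L u) ∧
     Continuous L) ∧
    -- (b) the Fréchet differentiability conditions (DZ) and (DR)
    (∀ (K : Finset ℕ) (hK : K.Nonempty) (ε : ℝ), 0 < ε →
      ∃ (I : Finset ℕ) (hI : I.Nonempty) (δ : ℝ), 0 < δ ∧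
        ∀ u : ℕ → ℝ,
          (I.sup' hI (fun i => |u i| / (1 + |u i|)) = 0 →
            K.sup' hK (fun k => |E u k| / (1 + |E u k|)) = 0) ∧
          (0 < I.sup' hI (fun i => |u i| / (1 + |u i|)) →
            I.sup' hI (fun i => |u i| / (1 + |u i|)) < δ →
            K.sup' hK (fun k =>
              (|E u k| / I.sup' hI (fun i => |u i| / (1 + |u i|))) /
                (1 + |E u k| / I.sup' hI (fun i => |u i| / (1 + |u i|)))) < ε)) := by
  refine ⟨⟨?_, ?_, ?_⟩, ?_⟩
  · intro u v
    ext n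
    simp only [Pi.add_apply, hL]
    ring
  · intro c u
    ext n
    simp only [Pi.smul_apply, smul_eq_mul, hL]
    ring
  · refine continuous_pi fun n => ?_
    simp only [hL]
    fun_prop
  · intro K hK ε hε
    have hev : ∀ᶠ t : ℝ in nhds 0, ∀ k ∈ K,
        |(xb k + t) ^ m - xb k ^ m - (m : ℝ) * xb k ^ (m - 1) * t| ≤ ε / 4 * |t| :=
      (Filter.eventually_all_finset K).2 fun k _ =>
        eventually_abs_pow_taylor_remainder_le m (xb k) (by positivity)
    obtain ⟨η, hη, hball⟩ := Metric.eventually_nhds_iff.1 hev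
    refine ⟨K, hK, min (1 / 2) (η / 2), by positivity, fun u => ?_⟩
    have hle : ∀ k ∈ K, |u k| / (1 + |u k|) ≤ K.sup' hK (fun i => |u i| / (1 + |u i|)) :=
      fun k hk => Finset.le_sup' (fun i => |u i| / (1 + |u i|)) hk
    generalize K.sup' hK (fun i => |u i| / (1 + |u i|)) = s at hle ⊢
    refine ⟨?_, ?_⟩
    · rintro rfl
      refine Finset.sup'_eq_of_forall hK _ fun k hk => ?_
      have hu : u k = 0 := by
        have := abs_le_two_mul_of_div_one_add_abs_le (by norm_num) (hle k hk)
        simpa using this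
      simp [hE, hu]
    · intro hs hsδ
      obtain ⟨hs_half, hsη⟩ := lt_min_iff.1 hsδ
      refine (Finset.sup'_lt_iff hK).2 fun k hk => ?_
      have hu := abs_le_two_mul_of_div_one_add_abs_le hs_half.le (hle k hk)
      have hEk : |E u k| ≤ ε / 4 * |u k| := by
        rw [hE]
        refine hball ?_ k hk
        rw [Real.dist_eq, sub_zero]
        linarith
      have hquot : |E u k| / s < ε := by
        rw [div_lt_iff₀ hs]
        nlinarith
      have hnonneg : 0 ≤ |E u k| / s := by positivity
      exact (div_le_self hnonneg (by linarith)).trans_lt hquot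
end

section
/- Let 0 < ρ < 1, let m be a positive integer, and let x̄ ∈ σ_ρ. For u ∈ σ_ρ and k ∈ ℕ set E_k(u) = (x̄(k) + u(k))^m − x̄(k)^m − m · x̄(k)^{m−1} · u(k). Then the linear map L(u) = (m · x̄(n)^{m−1} · u(n))_{n∈ℕ}, viewed as a map from σ_ρ into 𝕊, is continuous, and for every nonempty finite K ⊆ ℕ and every ε > 0 there exist a nonempty finite I ⊆ ℕ and δ > 0 such that for every u ∈ σ_ρ: if max_{i ∈ I} |u(i)|^ρ = 0 then max_{k ∈ K} |E_k(u)|/(1 + |E_k(u)|) = 0, and if 0 < s < δ where s = max_{i ∈ I} |u(i)|^ρ, then max_{k ∈ K} (|E_k(u)|/s) / (1 + |E_k(u)|/s) < ε. (That is, L is the Fréchet derivative at x̄ of the m-th power operator Λ^m : σ_ρ → 𝕊, with respect to the F-seminorms |x(k)|^ρ on the domain and |y(k)|/(1 + |y(k)|) on the range.) -/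
/-- The first-order Taylor remainder of `t ↦ t ^ m` at finitely many base points is uniformly
small relative to the increment. -/
theorem exists_forall_abs_pow_remainder_le (x : ℕ → ℝ) (m : ℕ) (K : Finset ℕ) {c : ℝ}
    (hc : 0 < c) :
    ∃ η > 0, ∀ t : ℝ, |t| < η → ∀ k ∈ K,
      |(x k + t) ^ m - x k ^ m - m * x k ^ (m - 1) * t| ≤ c * |t| := by
  have key : ∀ᶠ t in nhds (0 : ℝ), ∀ k ∈ K,
      |(x k + t) ^ m - x k ^ m - m * x k ^ (m - 1) * t| ≤ c * |t| := by
    rw [Filter.eventually_all_finset]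
    intro k _
    have h := (hasDerivAt_iff_isLittleO_nhds_zero.1 (hasDerivAt_pow m (x k))).def hc
    filter_upwards [h] with t ht
    simpa [mul_comm] using ht
  obtain ⟨η, hη, h⟩ := Metric.eventually_nhds_iff.1 key
  exact ⟨η, hη, fun t ht => h (by simpa using ht)⟩


theorem stmt17 (ρ : ℝ) (hρ0 : 0 < ρ) (hρ1 : ρ < 1) (m : ℕ) (hm : 0 < m)
    (xb : ℕ → ℝ) (hxb : Summable fun n => |xb n| ^ ρ)
    (L : (ℕ → ℝ) → (ℕ → ℝ))
    (hL : ∀ u n, L u n = (m : ℝ) * (xb n) ^ (m - 1) * u n)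
    (E : (ℕ → ℝ) → ℕ → ℝ)
    (hE : ∀ u k, E u k = (xb k + u k) ^ m - (xb k) ^ m - (m : ℝ) * (xb k) ^ (m - 1) * u k) :
    -- L, viewed as a map from σ_ρ into 𝕊, is continuous
    (Continuous fun u : {t : ℕ → ℝ // Summable fun n => |t n| ^ ρ} => L u.1) ∧
    -- the Fréchet differentiability conditions (DZ) and (DR) for Λ^m : σ_ρ → 𝕊
    (∀ (K : Finset ℕ) (hK : K.Nonempty) (ε : ℝ), 0 < ε →
      ∃ (I : Finset ℕ) (hI : I.Nonempty) (δ : ℝ), 0 < δ ∧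
        ∀ u : ℕ → ℝ, (Summable fun n => |u n| ^ ρ) →
          (I.sup' hI (fun i => |u i| ^ ρ) = 0 →
            K.sup' hK (fun k => |E u k| / (1 + |E u k|)) = 0) ∧
          (0 < I.sup' hI (fun i => |u i| ^ ρ) → I.sup' hI (fun i => |u i| ^ ρ) < δ →
            K.sup' hK (fun k =>
              (|E u k| / I.sup' hI (fun i => |u i| ^ ρ)) /
                (1 + |E u k| / I.sup' hI (fun i => |u i| ^ ρ))) < ε)) := by
  refine ⟨?_, fun K hK ε hε => ?_⟩
  · refine continuous_pi fun n => ?_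
    simp only [hL]
    exact continuous_const.mul ((continuous_apply n).comp continuous_subtype_val)
  obtain ⟨η, hη, h⟩ := exists_forall_abs_pow_remainder_le xb m K (half_pos hε)
  have hη1 : 0 < min η 1 := lt_min hη one_pos
  refine ⟨K, hK, min η 1 ^ ρ, Real.rpow_pos_of_pos hη1 ρ, fun u _ => ?_⟩
  have hle : ∀ k ∈ K, |u k| ^ ρ ≤ K.sup' hK (fun i => |u i| ^ ρ) :=
    fun k hk => Finset.le_sup' (fun i => |u i| ^ ρ) hk
  refine ⟨fun h0 => ?_, fun hs hsδ => ?_⟩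
  · have hz : ∀ k ∈ K, |E u k| / (1 + |E u k|) = 0 := by
      intro k hk
      have hpow : |u k| ^ ρ = 0 := le_antisymm (h0 ▸ hle k hk) (by positivity)
      have huk : u k = 0 :=
        abs_eq_zero.1 ((Real.rpow_eq_zero (abs_nonneg _) hρ0.ne').1 hpow)
      simp [hE, huk]
    rw [Finset.sup'_congr hK rfl hz, Finset.sup'_const]
  · generalize K.sup' hK (fun i => |u i| ^ ρ) = s at *
    rw [Finset.sup'_lt_iff]
    intro k hk
    have hlt : |u k| < min η 1 :=
      (Real.rpow_lt_rpow_iff (abs_nonneg _) hη1.le hρ0).1 ((hle k hk).trans_lt hsδ)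
    have hus : |u k| ≤ s := by
      refine le_trans ?_ (hle k hk)
      simpa using Real.rpow_le_rpow_of_exponent_ge' (abs_nonneg (u k))
        (hlt.le.trans (min_le_right _ _)) hρ0.le hρ1.le
    have hEs : |E u k| / s ≤ ε / 2 := by
      rw [div_le_iff₀ hs, hE]
      exact (h (u k) (hlt.trans_le (min_le_left _ _)) k hk).trans (by gcongr)
    have hq : 0 ≤ |E u k| / s := by positivity
    calc |E u k| / s / (1 + |E u k| / s) ≤ |E u k| / s := div_le_self hq (by linarith)
      _ < ε := by linarith
end
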